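/- Feng–Xiang setting; let D = ⋃_{i∈I} ω^i⟨ω^N⟩ be the Feng–Xiang skew Hadamard difference set with index set I and fix a ∈ F_p^* \ {1}. Then for all β, β' ∈ F_q^*, |T_{β,a}(D) − T_{β',a}(D)| ≤ 4N³√q, where √q is the real square root of q. -/

import Mathlib

/-- The triple intersection number `T_{β,a}(D) = |D ∩ (D - β) ∩ (D - aβ)|`. -/
noncomputable def tripleInt {F : Type*} [Field F] (β a : F) (D : Set F) : ℕ :=
  Set.ncard {x : F | x ∈ D ∧ x + β ∈ D ∧ x + a * β ∈ D}


section FXaux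
open Polynomial
universe u

lemma fx_sqfree {F : Type*} [Field F] (N : ℕ) (hN : (N : F) ≠ 0) (ρ : F) (h0 : ρ ≠ 0) (h1 : ρ ≠ 1) :
    Squarefree (C ρ * X ^ N + C (1 - ρ) : F[X]) := by
  have : (C ρ * X ^ N + C (1 - ρ) : F[X]) = C ρ * (X ^ N - C ((ρ - 1) / ρ)) := by
    rw [mul_sub, ← C_mul, mul_div_cancel₀ _ h0, C_sub, C_sub]
    ring
  rw [this]
  have hs : Squarefree (X ^ N - C ((ρ - 1) / ρ) : F[X]) :=
    (separable_X_pow_sub_C _ hN (div_ne_zero (sub_ne_zero.2 h1) h0)).squarefree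
  intro x hx
  refine hs x (hx.trans ?_)
  exact (IsUnit.dvd_mul_left (isUnit_C.2 (IsUnit.mk0 _ h0))).1 dvd_rfl

lemma fx_irred {F : Type*} [Field F] (N : ℕ) (hN0 : 0 < N) (c : F[X]) (hc : Squarefree c)
    (hcu : ¬ IsUnit c) : Irreducible (X ^ N - C c : F[X][X]) := by
  have hc0 : c ≠ 0 := hc.ne_zero
  obtain ⟨π, hπ, hd⟩ := WfDvdMonoid.exists_irreducible_factor hcu hc0
  have hP : (Ideal.span {π} : Ideal F[X]).IsPrime :=
    (Ideal.span_singleton_prime hπ.ne_zero).2 hπ.prime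
  have hm : (X ^ N - C c : F[X][X]).Monic := monic_X_pow_sub_C _ hN0.ne'
  have hdeg : (X ^ N - C c : F[X][X]).degree = N := degree_X_pow_sub_C hN0 _
  refine irreducible_of_eisenstein_criterion hP ?_ ?_ ?_ ?_ hm.isPrimitive
  · rw [hm.leadingCoeff]
    exact fun h => hP.ne_top ((Ideal.eq_top_iff_one _).2 h)
  · intro n hn
    rw [hdeg] at hn
    have hn' : n < N := by exact_mod_cast hn
    rw [coeff_sub, coeff_X_pow, coeff_C, if_neg hn'.ne]
    split_ifs
    · simpa [Ideal.mem_span_singleton] using hd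
    · simp
  · rw [hdeg]; exact_mod_cast hN0
  · rw [coeff_sub, coeff_X_pow, coeff_C, if_neg hN0.ne, if_pos rfl, zero_sub, neg_mem_iff,
      Ideal.span_singleton_pow, Ideal.mem_span_singleton, sq]
    exact fun h => hπ.not_isUnit (hc _ h)

lemma fx_indep1 {F : Type*} [Field F] (N : ℕ) (R : Fin N → F[X])
    (h : ∑ k : Fin N, expand F N (R k) * X ^ (k : ℕ) = 0) : R = 0 := by
  funext k
  ext m
  have hN : 0 < N := k.pos
  have h1 := congrArg (fun p => coeff p (m * N + k)) h
  simp only [finsetSum_coeff, coeff_mul_X_pow'] at h1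
  rw [Finset.sum_eq_single k] at h1
  · simpa [coeff_expand hN, hN.ne'] using h1
  · intro b _ hb
    split_ifs with hle
    · rw [coeff_expand hN, if_neg]
      intro hd
      apply hb
      have : (m * N + k) ≡ b [MOD N] := ((Nat.modEq_iff_dvd' hle).2 hd).symm
      have h3 : (m * N + k) % N = b % N := this
      rw [Nat.mul_add_mod', Nat.mod_eq_of_lt k.2, Nat.mod_eq_of_lt b.2] at h3
      exact Fin.ext h3.symm
    · rfl
  · simp

lemma fx_indep {F : Type u} [Field F] (N : ℕ) (hN : (N : F) ≠ 0) (b1 b2 : F) (h1 : b1 ≠ 0)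
    (h2 : b2 ≠ 0) (h12 : b1 ≠ b2) :
    ∃ (B : Type u) (_ : CommRing B) (_ : IsDomain B) (φ : F[X] →+* B) (U V : B),
      U ^ N = φ (1 + C b1⁻¹ * X) ∧ V ^ N = φ (1 + C b2⁻¹ * X) ∧
      ∀ P : Fin N × Fin N → F[X], ∑ jk, φ (P jk) * (U ^ (jk.1 : ℕ) * V ^ (jk.2 : ℕ)) = 0 → P = 0 := by
  have hN0 : 0 < N := Nat.pos_of_ne_zero (by rintro rfl; simp at hN)
  set ρ := b2 / b1 with hρ
  have hρ0 : ρ ≠ 0 := div_ne_zero h2 h1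
  have hρ1 : ρ ≠ 1 := by rw [hρ, Ne, div_eq_one_iff_eq h1]; exact h12.symm
  set c : F[X] := C ρ * X ^ N + C (1 - ρ) with hc
  have hcu : ¬ IsUnit c := by
    intro hu
    have := natDegree_eq_zero_of_isUnit hu
    rw [hc, natDegree_add_C, natDegree_C_mul_X_pow _ _ hρ0] at this
    omega
  have hirr := fx_irred N hN0 c (fx_sqfree N hN ρ hρ0 hρ1) hcu
  set Q : F[X][X] := X ^ N - C c with hQ
  have hQm : Q.Monic := monic_X_pow_sub_C _ hN0.ne'
  have hdom := AdjoinRoot.isDomain_of_prime hirr.prime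
  let ψ : F[X] →+* F[X] := (compRingHom (C b2 * (X ^ N - 1)))
  refine ⟨AdjoinRoot Q, inferInstance, hdom, (AdjoinRoot.of Q).comp ψ, AdjoinRoot.root Q,
    AdjoinRoot.of Q X, ?_, ?_, ?_⟩
  · have := AdjoinRoot.eval₂_root Q
    rw [hQ, eval₂_sub, eval₂_X_pow, eval₂_C, sub_eq_zero] at this
    rw [this]
    simp only [RingHom.comp_apply, ψ, coe_compRingHom_apply]
    congr 1
    simp only [hc, hρ, add_comp, mul_comp, C_comp, X_comp, one_comp]
    rw [← mul_assoc, ← C_mul, inv_mul_eq_div, C_sub, C_1]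
    ring
  · simp only [RingHom.comp_apply, ψ, coe_compRingHom_apply, ← map_pow]
    congr 1
    simp only [add_comp, mul_comp, C_comp, X_comp, one_comp]
    rw [← mul_assoc, ← C_mul, inv_mul_cancel₀ h2, C_1]
    ring
  · intro P hP
    have hz : AdjoinRoot.mk Q (∑ j : Fin N, C (∑ k : Fin N, ψ (P (j, k)) * X ^ (k : ℕ)) * X ^ (j : ℕ)) = 0 := by
      rw [← hP, Fintype.sum_prod_type, map_sum]
      refine Finset.sum_congr rfl fun j _ => ?_
      rw [map_mul, map_pow, AdjoinRoot.mk_X, AdjoinRoot.mk_C, map_sum, Finset.sum_mul]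
      refine Finset.sum_congr rfl fun k _ => ?_
      rw [map_mul, map_pow]
      simp only [RingHom.comp_apply]
      ring
    rw [AdjoinRoot.mk_eq_zero] at hz
    have hz0 := eq_zero_of_dvd_of_degree_lt hz (by
      rw [hQ, degree_X_pow_sub_C hN0]
      refine (degree_sum_fin_lt (fun j : Fin N => ∑ k : Fin N, ψ (P (j, k)) * X ^ (k : ℕ))))
    have hj : ∀ j : Fin N, ∑ k : Fin N, ψ (P (j, k)) * X ^ (k : ℕ) = 0 := by
      intro j
      have := congrArg (fun p => coeff p (j : ℕ)) hz0
      simp only [finsetSum_coeff, coeff_C_mul, coeff_X_pow, coeff_zero] at this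
      rw [Finset.sum_eq_single j] at this
      · simpa using this
      · intro b _ hb
        rw [if_neg (fun h => hb (Fin.ext h.symm)), mul_zero]
      · simp
    have hexp : ∀ p : F[X], ψ p = expand F N (p.comp (C b2 * (X - 1))) := by
      intro p
      simp only [ψ, coe_compRingHom_apply, expand_eq_comp_X_pow, comp_assoc]
      congr 1
      simp
    funext ⟨j, k⟩
    have h5 := congrFun (fx_indep1 N (fun k => (P (j, k)).comp (C b2 * (X - 1))) (by
      simpa only [hexp] using hj j)) k
    simp only [Pi.zero_apply] at h5 ⊢
    have h6 := congrArg (fun p => p.comp (C b2⁻¹ * X + 1)) h5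
    simp only [comp_assoc, zero_comp] at h6
    have h7 : ((C b2 * (X - 1) : F[X]).comp (C b2⁻¹ * X + 1)) = X := by
      simp only [mul_comp, C_comp, sub_comp, X_comp, one_comp, add_sub_cancel_right]
      rw [← mul_assoc, ← C_mul, mul_inv_cancel₀ h2, C_1, one_mul]
    rwa [h7, comp_X] at h6


/-- multiplication matrix -/
noncomputable def fxMat {F : Type*} [Field F] (N : ℕ) [NeZero N] (A1 A2 : F[X])
    (P : Fin N × Fin N → F[X]) : Matrix (Fin N × Fin N) (Fin N × Fin N) F[X] :=
  fun st jk => P (jk.1 - st.1, jk.2 - st.2) *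
    (A1 ^ (if jk.1 < st.1 then 1 else 0) * A2 ^ (if jk.2 < st.2 then 1 else 0))

lemma fx_carry (N : ℕ) [NeZero N] (s j : Fin N) :
    (s : ℕ) + ((j - s : Fin N) : ℕ) = j + N * (if j < s then 1 else 0) := by
  have h1 := s.2
  have h2 := j.2
  split_ifs with h
  · rw [Fin.lt_def] at h
    rw [Fin.sub_def]
    simp only
    rw [Nat.mod_eq_of_lt (by omega)]
    omega
  · rw [Fin.lt_def] at h
    rw [Fin.sub_def]
    simp only
    rw [show N - (s : ℕ) + j = (j - s) + N by omega, Nat.add_mod_right, Nat.mod_eq_of_lt (by omega)]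
    omega

lemma fxMat_mul {F : Type*} [Field F] (N : ℕ) [NeZero N] (A1 A2 : F[X])
    (P : Fin N × Fin N → F[X]) {B : Type*} [CommRing B] (φ : F[X] →+* B) (u v : B)
    (hu : u ^ N = φ A1) (hv : v ^ N = φ A2) (st : Fin N × Fin N) :
    ∑ jk, φ (fxMat N A1 A2 P st jk) * (u ^ (jk.1 : ℕ) * v ^ (jk.2 : ℕ)) =
      (u ^ (st.1 : ℕ) * v ^ (st.2 : ℕ)) *
        ∑ jk, φ (P jk) * (u ^ (jk.1 : ℕ) * v ^ (jk.2 : ℕ)) := by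
  rw [Finset.mul_sum, ← (Equiv.subRight st).sum_comp (fun jk => (u ^ (st.1 : ℕ) * v ^ (st.2 : ℕ)) *
    (φ (P jk) * (u ^ (jk.1 : ℕ) * v ^ (jk.2 : ℕ))))]
  refine Finset.sum_congr rfl fun jk _ => ?_
  simp only [Equiv.subRight_apply, fxMat, map_mul, map_pow, ← hu, ← hv, ← pow_mul]
  have e1 := fx_carry N st.1 jk.1
  have e2 := fx_carry N st.2 jk.2
  have h1 : u ^ (st.1 : ℕ) * u ^ ((jk.1 - st.1 : Fin N) : ℕ) =
      u ^ (jk.1 : ℕ) * u ^ (N * (if jk.1 < st.1 then 1 else 0)) := by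
    rw [← pow_add, ← pow_add, e1]
  have h2 : v ^ (st.2 : ℕ) * v ^ ((jk.2 - st.2 : Fin N) : ℕ) =
      v ^ (jk.2 : ℕ) * v ^ (N * (if jk.2 < st.2 then 1 else 0)) := by
    rw [← pow_add, ← pow_add, e2]
  change φ (P (jk - st)) * _ * _ = _ * (φ (P (jk - st)) * (u ^ ((jk.1 - st.1 : Fin N) : ℕ) *
    v ^ ((jk.2 - st.2 : Fin N) : ℕ)))
  linear_combination (-φ (P (jk - st)) * v ^ (jk.2 : ℕ) *
    v ^ (N * (if jk.2 < st.2 then 1 else 0))) * h1 -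
    (φ (P (jk - st)) * u ^ (st.1 : ℕ) * u ^ ((jk.1 - st.1 : Fin N) : ℕ)) * h2

lemma fx_det_deg {F : Type*} [Field F] {ι : Type*} [Fintype ι] [DecidableEq ι]
    (M : Matrix ι ι F[X]) (D : ℕ) (h : ∀ i j, (M i j).natDegree ≤ D) :
    M.det.natDegree ≤ Fintype.card ι * D := by
  rw [Matrix.det_apply]
  refine natDegree_sum_le_of_forall_le _ _ fun σ _ => ?_
  refine (natDegree_smul_le _ _).trans ?_
  refine (natDegree_prod_le _ _).trans ?_
  refine (Finset.sum_le_card_nsmul _ _ D fun i _ => h _ _).trans ?_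
  simp

/-- zero estimate, abstract form -/
lemma fx_zero_abs {F : Type*} [Field F] (N : ℕ) [NeZero N] (hN : (N : F) ≠ 0) (b1 b2 : F)
    (h1 : b1 ≠ 0) (h2 : b2 ≠ 0) (h12 : b1 ≠ b2) (e d : ℕ) (hd : N ^ 2 * (d + 2) < e)
    {B : Type*} [CommRing B] (φ : F[X] →+* B) (hφ : ∀ p, φ p = 0 → X ^ e ∣ p) (u v : B)
    (hu : u ^ N = φ (1 + C b1⁻¹ * X)) (hv : v ^ N = φ (1 + C b2⁻¹ * X))
    (P : Fin N × Fin N → F[X]) (hP : ∀ jk, (P jk).natDegree ≤ d)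
    (h : ∑ jk, φ (P jk) * (u ^ (jk.1 : ℕ) * v ^ (jk.2 : ℕ)) = 0) : P = 0 := by
  classical
  set A1 : F[X] := 1 + C b1⁻¹ * X with hA1
  set A2 : F[X] := 1 + C b2⁻¹ * X with hA2
  have hdA : ∀ b : F, (1 + C b * X : F[X]).natDegree ≤ 1 := by
    intro b
    refine natDegree_add_le_of_degree_le (by simp) (natDegree_C_mul_le b X |>.trans natDegree_X_le)
  have hdA' : ∀ (b : F) (q : Prop) [Decidable q],
      ((1 + C b * X : F[X]) ^ (if q then 1 else 0)).natDegree ≤ 1 := by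
    intro b q _
    split_ifs
    · simpa using hdA b
    · simp
  set M := fxMat N A1 A2 P with hM
  have hMdeg : ∀ i j, (M i j).natDegree ≤ d + 2 := by
    intro i j
    refine natDegree_mul_le.trans (Nat.add_le_add (hP _) (natDegree_mul_le.trans ?_))
    exact Nat.add_le_add (hdA' _ _) (hdA' _ _)
  have hdet : M.det = 0 := by
    have hle := fx_det_deg M _ hMdeg
    have hdvd : X ^ e ∣ M.det := by
      apply hφ
      set w : Fin N × Fin N → B := fun jk => u ^ (jk.1 : ℕ) * v ^ (jk.2 : ℕ) with hw
      have hMw : (M.map φ).mulVec w = 0 := by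
        funext st
        have := fxMat_mul N A1 A2 P φ u v hu hv st
        rw [h, mul_zero] at this
        simpa [Matrix.mulVec, dotProduct] using this
      have h3 : (M.map φ).adjugate.mulVec ((M.map φ).mulVec w) = 0 := by
        rw [hMw, Matrix.mulVec_zero]
      rw [Matrix.mulVec_mulVec, Matrix.adjugate_mul, Matrix.smul_mulVec, Matrix.one_mulVec] at h3
      have h4 := congrFun h3 (0, 0)
      rw [RingHom.map_det]
      simpa [hw] using h4
    by_contra hne
    have := natDegree_le_of_dvd hdvd hne
    rw [natDegree_X_pow] at this
    simp only [Fintype.card_prod, Fintype.card_fin] at hle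
    rw [sq] at hd
    omega
  obtain ⟨c, hc0, hc⟩ := Matrix.exists_vecMul_eq_zero_iff.2 hdet
  obtain ⟨B', _, _, ψ, U, V, hU, hV, hind⟩ := fx_indep N hN b1 b2 h1 h2 h12
  have hprod : (∑ st, ψ (c st) * (U ^ (st.1 : ℕ) * V ^ (st.2 : ℕ))) *
      (∑ jk, ψ (P jk) * (U ^ (jk.1 : ℕ) * V ^ (jk.2 : ℕ))) = 0 := by
    rw [Finset.sum_mul]
    simp_rw [mul_assoc (ψ _) (U ^ _ * V ^ _) (Finset.sum _ _), ← fxMat_mul N A1 A2 P ψ U V hU hV, Finset.mul_sum]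
    rw [Finset.sum_comm]
    refine Finset.sum_eq_zero fun jk _ => ?_
    have := congrFun hc jk
    simp only [Matrix.vecMul, dotProduct, Pi.zero_apply] at this
    have h7 := congrArg ψ this
    rw [map_sum, map_zero] at h7
    rw [← zero_mul (U ^ (jk.1 : ℕ) * V ^ (jk.2 : ℕ)), ← h7, Finset.sum_mul]
    refine Finset.sum_congr rfl fun st _ => ?_
    rw [map_mul, mul_assoc]
  rcases mul_eq_zero.1 hprod with h8 | h8
  · exact absurd (hind c h8) hc0
  · exact hind P h8

/-- zero estimate, concrete form -/
lemma fx_zero {F : Type*} [Field F] (N : ℕ) [NeZero N] (hN : (N : F) ≠ 0) (b1 b2 : F)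
    (h1 : b1 ≠ 0) (h2 : b2 ≠ 0) (h12 : b1 ≠ b2) (e d q : ℕ) (hd : N ^ 2 * (d + 2) < e)
    (hq : q = N * e + 1)
    (hfrob : ∀ b : F, (X + C b : F[X]) ^ q = X ^ q + C b)
    (P : Fin N × Fin N → F[X]) (hP : ∀ jk, (P jk).natDegree ≤ d)
    (h : X ^ e ∣ ∑ jk, P jk * ((X + C b1) ^ ((N - 1 - jk.1) * e) * (X + C b2) ^ ((N - 1 - jk.2) * e))) :
    P = 0 := by
  have hNpos : 0 < N := NeZero.pos N
  set φ := Ideal.Quotient.mk (Ideal.span {(X ^ e : F[X])}) with hφdef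
  have hφ : ∀ p, φ p = 0 ↔ X ^ e ∣ p := by
    intro p
    rw [hφdef, Ideal.Quotient.eq_zero_iff_mem, Ideal.mem_span_singleton]
  have hXe : e ≤ q := by rw [hq]; nlinarith
  have key : ∀ b : F, b ≠ 0 → φ (1 + C b⁻¹ * X) * (φ ((X + C b) ^ e)) ^ N = 1 := by
    intro b hb
    rw [← map_pow, ← map_mul, ← sub_eq_zero, ← map_one φ, ← map_sub, hφ]
    have : (1 + C b⁻¹ * X : F[X]) = C b⁻¹ * (X + C b) := by
      rw [mul_add, ← C_mul, inv_mul_cancel₀ hb, C_1]; ring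
    rw [this, ← pow_mul, mul_assoc, ← pow_succ', mul_comm e N, ← hq, hfrob, mul_add, ← C_mul,
      inv_mul_cancel₀ hb, C_1, add_sub_cancel_right]
    exact (pow_dvd_pow X hXe).mul_left _
  obtain ⟨n, rfl⟩ : ∃ n, N = n + 1 := ⟨N - 1, by omega⟩
  have root : ∀ A u : F[X] ⧸ Ideal.span {(X ^ e : F[X])}, A * u ^ (n + 1) = 1 →
      (A * u ^ n) ^ (n + 1) = A ∧ (A * u ^ n) * u = 1 := by
    intro A u h
    have h' : (A * u ^ n) * u = 1 := by rw [← h]; ring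
    refine ⟨?_, h'⟩
    calc (A * u ^ n) ^ (n + 1) = A * (A * u ^ (n + 1)) ^ n := by ring
      _ = A := by rw [h]; simp
  obtain ⟨r1, i1⟩ := root _ _ (key b1 h1)
  obtain ⟨r2, i2⟩ := root _ _ (key b2 h2)
  refine fx_zero_abs (n + 1) hN b1 b2 h1 h2 h12 e d hd φ (fun p => (hφ p).1) _ _ r1 r2 P hP ?_
  rw [← hφ, map_sum] at h
  set u := φ ((X + C b1) ^ e) with hu
  set v := φ ((X + C b2) ^ e) with hv
  set u' := φ (1 + C b1⁻¹ * X) * u ^ n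
  set v' := φ (1 + C b2⁻¹ * X) * v ^ n
  have inv : ∀ x y : F[X] ⧸ Ideal.span {(X ^ e : F[X])}, x * y = 1 → ∀ j : Fin (n + 1),
      x ^ n * y ^ (n - j) = x ^ (j : ℕ) := by
    intro x y hxy j
    have hj : (j : ℕ) + (n - j) = n := by omega
    calc x ^ n * y ^ (n - j) = x ^ ((j : ℕ) + (n - j)) * y ^ (n - j) := by rw [hj]
      _ = x ^ (j : ℕ) * (x * y) ^ (n - j) := by rw [pow_add, mul_pow, mul_assoc]
      _ = _ := by rw [hxy]; simp
  have h9 := congrArg (fun z => (u' ^ n * v' ^ n) * z) h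
  simp only [mul_zero, Finset.mul_sum] at h9
  rw [← h9]
  refine Finset.sum_congr rfl fun jk _ => ?_
  rw [← inv u' u i1, ← inv v' v i2, map_mul, map_mul, mul_comm _ e, mul_comm _ e, pow_mul, pow_mul,
    map_pow φ ((X + C b1) ^ e), map_pow φ ((X + C b2) ^ e), ← hu, ← hv, Nat.add_sub_cancel]
  ring


lemma fx_hasse_one {F : Type*} [Field F] {s : ℕ} (hs : 0 < s) : hasseDeriv s (1 : F[X]) = 0 :=
  hasseDeriv_eq_zero_of_lt_natDegree _ _ (by simpa using hs)

lemma fx_block {F : Type*} [Field F] (B L : ℕ) (G : Fin L → F[X])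
    (hG : ∀ l, X ^ B ∣ G l → G l = 0)
    (h : X ^ (B * L) ∣ ∑ l, G l * X ^ (B * (l : ℕ))) : ∀ l, G l = 0 := by
  intro l
  induction l using WellFoundedLT.induction with
  | ind l ih =>
    apply hG
    have h1 : X ^ (B * ((l : ℕ) + 1)) ∣ ∑ l', G l' * X ^ (B * (l' : ℕ)) :=
      (pow_dvd_pow X (Nat.mul_le_mul_left B l.2)).trans h
    rw [← Finset.add_sum_erase _ _ (Finset.mem_univ l)] at h1
    have h2 : (X : F[X]) ^ (B * ((l : ℕ) + 1)) ∣
        ∑ l' ∈ Finset.univ.erase l, G l' * X ^ (B * (l' : ℕ)) := by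
      refine Finset.dvd_sum fun l' hl' => ?_
      rcases lt_or_gt_of_ne (Finset.ne_of_mem_erase hl') with hlt | hgt
      · rw [ih l' hlt]; simp
      · exact (pow_dvd_pow X (Nat.mul_le_mul_left B hgt)).mul_left _
    have h3 := (dvd_add_left h2).1 h1
    rw [mul_add, mul_one, pow_add, mul_comm] at h3
    exact (mul_dvd_mul_iff_right (pow_ne_zero _ X_ne_zero)).1 h3

/-- logarithmic-derivative property -/
def FXLog {F : Type*} [Field F] (h g : F[X]) : Prop :=
  ∃ K : ℕ → F[X], ∀ s, h ^ s * hasseDeriv s g = g * K s ∧ (K s).natDegree ≤ 2 * s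

lemma FXLog.mul {F : Type*} [Field F] {h g1 g2 : F[X]} (H1 : FXLog h g1) (H2 : FXLog h g2) :
    FXLog h (g1 * g2) := by
  obtain ⟨K1, hK1⟩ := H1
  obtain ⟨K2, hK2⟩ := H2
  refine ⟨fun s => ∑ ij ∈ Finset.HasAntidiagonal.antidiagonal s, K1 ij.1 * K2 ij.2, fun s => ⟨?_, ?_⟩⟩
  · rw [hasseDeriv_mul, Finset.mul_sum, Finset.mul_sum]
    refine Finset.sum_congr rfl fun ij hij => ?_
    rw [← Finset.HasAntidiagonal.mem_antidiagonal.1 hij, pow_add]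
    linear_combination (h ^ ij.2 * hasseDeriv ij.2 g2) * (hK1 ij.1).1 + g1 * K1 ij.1 * (hK2 ij.2).1
  · refine natDegree_sum_le_of_forall_le _ _ fun ij hij => ?_
    have := Finset.HasAntidiagonal.mem_antidiagonal.1 hij
    have h1 := (hK1 ij.1).2
    have h2 := (hK2 ij.2).2
    refine natDegree_mul_le.trans ?_
    omega

lemma FXLog.pow {F : Type*} [Field F] {h g : F[X]} (H : FXLog h g) (n : ℕ) : FXLog h (g ^ n) := by
  induction n with
  | zero =>
    refine ⟨fun s => if s = 0 then 1 else 0, fun s => ?_⟩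
    rcases Nat.eq_zero_or_pos s with rfl | hs
    · simp
    · simp [fx_hasse_one hs, hs.ne']
  | succ n ih => rw [pow_succ]; exact ih.mul H

lemma FXLog.lin {F : Type*} [Field F] (h h' : F[X]) (b : F) (e : h = (X + C b) * h')
    (hd : h'.natDegree ≤ 2) : FXLog h (X + C b) := by
  refine ⟨fun s => if s = 0 then 1 else if s = 1 then h' else 0, fun s => ?_⟩
  rcases s with _ | _ | s
  · simp
  · simp [e, hd]
  · rw [hasseDeriv_eq_zero_of_lt_natDegree]
    · simp
    · rw [natDegree_X_add_C]; omega

lemma fx_hasse_X_pow {F : Type*} [Field F] (q : ℕ)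
    (hch : ∀ s, 0 < s → s < q → (q.choose s : F) = 0) (l s : ℕ) (hs : 0 < s) (hsq : s < q) :
    hasseDeriv s (X ^ (q * l) : F[X]) = 0 := by
  induction l generalizing s with
  | zero => simp [fx_hasse_one hs]
  | succ l ih =>
    rw [mul_add, mul_one, pow_add, hasseDeriv_mul]
    refine Finset.sum_eq_zero fun ij hij => ?_
    have := Finset.HasAntidiagonal.mem_antidiagonal.1 hij
    rcases Nat.eq_zero_or_pos ij.1 with h0 | h0
    · have : hasseDeriv ij.2 (X ^ q : F[X]) = 0 := by
        rw [← monomial_one_right_eq_X_pow, hasseDeriv_monomial, hch _ (by omega) (by omega)]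
        simp
      rw [this, mul_zero]
    · rw [ih _ h0 (by omega), zero_mul]

lemma fx_hasse_mul_X_pow {F : Type*} [Field F] (q : ℕ)
    (hch : ∀ s, 0 < s → s < q → (q.choose s : F) = 0) (l r : ℕ) (hr : r < q) (f : F[X]) :
    hasseDeriv r (f * X ^ (q * l) : F[X]) = hasseDeriv r f * X ^ (q * l) := by
  rw [hasseDeriv_mul, Finset.sum_eq_single (r, 0)]
  · simp
  · intro ij hij hne
    have := Finset.HasAntidiagonal.mem_antidiagonal.1 hij
    rw [fx_hasse_X_pow q hch l, mul_zero]
    · by_contra h0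
      apply hne
      ext <;> simp <;> omega
    · omega
  · simp

lemma fx_dvd_of_hasse {F : Type*} [Field F] (f : F[X]) (x : F) (M : ℕ)
    (h : ∀ r < M, (hasseDeriv r f).eval x = 0) : (X - C x) ^ M ∣ f := by
  rw [X_sub_C_pow_dvd_iff, X_pow_dvd_iff]
  intro r hr
  rw [← h r hr, ← taylor_coeff, taylor_apply]

lemma fx_card_le {F : Type*} [Field F] (f : F[X]) (hf : f ≠ 0) (A : Finset F) (M : ℕ)
    (h : ∀ x ∈ A, (X - C x) ^ M ∣ f) : M * A.card ≤ f.natDegree := by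
  have h1 : ∏ x ∈ A, (X - C x) ^ M ∣ f := by
    refine Finset.prod_dvd_of_coprime ?_ h
    intro x _ y _ hxy
    exact (pairwise_coprime_X_sub_C Function.injective_id hxy).pow
  have h2 := natDegree_le_of_dvd h1 hf
  rw [natDegree_prod_of_monic _ _ (fun x _ => (monic_X_sub_C x).pow M)] at h2
  simpa [mul_comm] using h2

/-- Basis functions. -/
noncomputable def fxg {F : Type*} [Field F] (N e : ℕ) (b1 b2 : F) (x : Fin N × (Fin N × Fin N)) :
    F[X] :=
  (X + C 0) ^ ((x.1 : ℕ) * e) *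
    ((X + C b1) ^ ((N - 1 - x.2.1) * e) * (X + C b2) ^ ((N - 1 - x.2.2) * e))

lemma fx_nonzero {F : Type*} [Field F] (N : ℕ) [NeZero N] (hN : (N : F) ≠ 0) (b1 b2 : F)
    (h1 : b1 ≠ 0) (h2 : b2 ≠ 0) (h12 : b1 ≠ b2) (e d q L : ℕ) (hd : N ^ 2 * (d + 2) < e)
    (hq : q = N * e + 1)
    (hfrob : ∀ b : F, (X + C b : F[X]) ^ q = X ^ q + C b)
    (P : Fin N × (Fin N × Fin N) → Fin L → F[X]) (hP : ∀ x l, (P x l).natDegree ≤ d)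
    (h : ∑ l, (∑ x, P x l * fxg N e b1 b2 x) * X ^ (q * (l : ℕ)) = 0) : P = 0 := by
  have hin : ∀ l, X ^ (e * N) ∣ (∑ x, P x l * fxg N e b1 b2 x) → ∀ x, P x l = 0 := by
    intro l hl
    have hrw : (∑ x, P x l * fxg N e b1 b2 x) = ∑ i : Fin N, (∑ jk : Fin N × Fin N, P (i, jk) l *
        ((X + C b1) ^ ((N - 1 - jk.1) * e) * (X + C b2) ^ ((N - 1 - jk.2) * e))) *
        X ^ (e * (i : ℕ)) := by
      rw [Fintype.sum_prod_type]
      refine Finset.sum_congr rfl fun i _ => ?_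
      rw [Finset.sum_mul]
      refine Finset.sum_congr rfl fun jk _ => ?_
      simp only [fxg, C_0, add_zero]
      rw [mul_comm e]
      ring
    rw [hrw] at hl
    have hz : ∀ i, X ^ e ∣ (∑ jk : Fin N × Fin N, P (i, jk) l *
        ((X + C b1) ^ ((N - 1 - jk.1) * e) * (X + C b2) ^ ((N - 1 - jk.2) * e))) →
        (fun jk => P (i, jk) l) = 0 := fun i hi =>
      fx_zero N hN b1 b2 h1 h2 h12 e d q hd hq hfrob (fun jk => P (i, jk) l) (fun jk => hP _ _) hi
    have := fx_block e N _ (fun i hi => by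
      have h5 := hz i hi
      refine Finset.sum_eq_zero fun jk _ => ?_
      rw [show P (i, jk) l = 0 from congrFun h5 jk, zero_mul]) hl
    rintro ⟨i, jk⟩
    exact congrFun (hz i (by rw [this i]; exact dvd_zero _)) jk
  have hle : e * N ≤ q := by rw [hq, mul_comm]; omega
  have hout := fx_block q L (fun l => ∑ x, P x l * fxg N e b1 b2 x) (fun l hl => by
    refine Finset.sum_eq_zero fun x _ => ?_
    rw [hin l ((pow_dvd_pow X hle).trans hl) x, zero_mul]) (by rw [h]; exact dvd_zero _)
  funext x l
  exact hin l (by rw [hout l]; exact dvd_zero _) x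

lemma fx_g_deg {F : Type*} [Field F] (N e : ℕ) (b1 b2 : F) (x : Fin N × (Fin N × Fin N)) :
    (fxg N e b1 b2 x).natDegree ≤ 3 * ((N - 1) * e) := by
  have h : ∀ (b : F) (m : ℕ), m ≤ N - 1 → ((X + C b : F[X]) ^ (m * e)).natDegree ≤ (N - 1) * e := by
    intro b m hm
    rw [natDegree_pow, natDegree_X_add_C, mul_one]
    exact Nat.mul_le_mul_right _ hm
  have h1 := h 0 x.1 (by omega)
  have h2 := h b1 (N - 1 - x.2.1) (by omega)
  have h3 := h b2 (N - 1 - x.2.2) (by omega)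
  unfold fxg
  refine natDegree_mul_le.trans ?_
  have := natDegree_mul_le (p := (X + C b1) ^ ((N - 1 - x.2.1) * e)) (q := (X + C b2) ^ ((N - 1 - x.2.2) * e))
  omega

lemma fx_stepanov {F : Type*} [Field F] (N : ℕ) [NeZero N] (hN : (N : F) ≠ 0) (b1 b2 : F)
    (h1 : b1 ≠ 0) (h2 : b2 ≠ 0) (h12 : b1 ≠ b2) (e d q L M : ℕ) (hd : N ^ 2 * (d + 2) < e)
    (hq : q = N * e + 1)
    (hfrob : ∀ b : F, (X + C b : F[X]) ^ q = X ^ q + C b)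
    (hch : ∀ s, 0 < s → s < q → (q.choose s : F) = 0)
    (hFq : ∀ x : F, x ^ q = x) (hMq : M ≤ q)
    (hcount : M * (d + L + M) < N ^ 3 * L * (d + 1))
    (c1 c2 c3 : F) (hc1 : c1 ≠ 0) (hc2 : c2 ≠ 0) (hc3 : c3 ≠ 0)
    (A : Finset F) (hA : ∀ x ∈ A, x ^ e = c1 ∧ (x + b1) ^ e = c2 ∧ (x + b2) ^ e = c3) :
    M * A.card ≤ q * (L + 2) := by
  classical
  have he : 0 < e := by omega
  have hNpos : 0 < N := NeZero.pos N
  set h : F[X] := (X + C 0) * ((X + C b1) * (X + C b2)) with hh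
  have hdeg2 : ∀ a b : F, ((X + C a) * (X + C b) : F[X]).natDegree ≤ 2 := by
    intro a b
    refine natDegree_mul_le.trans ?_
    simp
  have hhdeg : h.natDegree ≤ 3 := by
    refine natDegree_mul_le.trans ?_
    have := hdeg2 b1 b2
    rw [natDegree_X_add_C]; omega
  have hlog : ∀ x, FXLog h (fxg N e b1 b2 x) := by
    intro x
    refine FXLog.mul (FXLog.pow ?_ _) (FXLog.mul (FXLog.pow ?_ _) (FXLog.pow ?_ _))
    · exact FXLog.lin h _ 0 hh (hdeg2 _ _)
    · exact FXLog.lin h ((X + C 0) * (X + C b2)) b1 (by rw [hh]; ring) (hdeg2 _ _)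
    · exact FXLog.lin h ((X + C 0) * (X + C b1)) b2 (by rw [hh]; ring) (hdeg2 _ _)
  clear_value h
  choose K hK using hlog
  let κ : Fin N × (Fin N × Fin N) → F := fun x =>
    c1 ^ (x.1 : ℕ) * (c2 ^ (N - 1 - x.2.1 : ℕ) * c3 ^ (N - 1 - x.2.2 : ℕ))
  let Q : ℕ → (Fin N × (Fin N × Fin N)) → F[X] →ₗ[F] F[X] := fun r x =>
    ∑ ts ∈ Finset.HasAntidiagonal.antidiagonal r, (LinearMap.mulLeft F (h ^ ts.1 * K x ts.2)) ∘ₗ hasseDeriv ts.1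
  have hQapp : ∀ r x p, Q r x p = ∑ ts ∈ Finset.HasAntidiagonal.antidiagonal r,
      h ^ ts.1 * K x ts.2 * hasseDeriv ts.1 p := by
    intro r x p
    simp [Q, LinearMap.sum_apply, mul_assoc]
  have hQ : ∀ r x p, h ^ r * hasseDeriv r (p * fxg N e b1 b2 x) = fxg N e b1 b2 x * Q r x p := by
    intro r x p
    rw [hQapp, hasseDeriv_mul, Finset.mul_sum, Finset.mul_sum]
    refine Finset.sum_congr rfl fun ts hts => ?_
    rw [← Finset.HasAntidiagonal.mem_antidiagonal.1 hts, pow_add]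
    linear_combination h ^ ts.1 * hasseDeriv ts.1 p * (hK x ts.2).1
  have hQdeg : ∀ r x p, p.natDegree ≤ d → (Q r x p).natDegree ≤ d + 2 * r := by
    intro r x p hp
    rw [hQapp]
    refine natDegree_sum_le_of_forall_le _ _ fun ts hts => ?_
    have h3 := Finset.HasAntidiagonal.mem_antidiagonal.1 hts
    have h4 := (hK x ts.2).2
    have h5 := natDegree_hasseDeriv_le p ts.1
    have h6 : (h ^ ts.1).natDegree ≤ ts.1 * 3 :=
      natDegree_pow_le.trans (Nat.mul_le_mul_left _ hhdeg)
    by_cases hlt : p.natDegree < ts.1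
    · rw [hasseDeriv_eq_zero_of_lt_natDegree _ _ hlt]; simp
    have h7 := natDegree_mul_le (p := h ^ ts.1 * K x ts.2) (q := hasseDeriv ts.1 p)
    have h8 := natDegree_mul_le (p := h ^ ts.1) (q := K x ts.2)
    omega
  let V := (Fin N × (Fin N × Fin N)) × Fin L → degreeLT F (d + 1)
  let R : ℕ → V →ₗ[F] F[X] := fun r =>
    ∑ y : (Fin N × (Fin N × Fin N)) × Fin L,
      (LinearMap.mulLeft F (C (κ y.1) * X ^ (y.2 : ℕ))) ∘ₗ (Q r y.1) ∘ₗ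
        (Submodule.subtype _) ∘ₗ (LinearMap.proj y)
  have hRapp : ∀ r (P : V), R r P = ∑ y : (Fin N × (Fin N × Fin N)) × Fin L,
      C (κ y.1) * X ^ (y.2 : ℕ) * Q r y.1 (P y : F[X]) := by
    intro r P
    simp [R, LinearMap.sum_apply, mul_assoc]
    rfl
  let W := ((r : Fin M) × Fin (d + L + 2 * (r : ℕ))) → F
  let T : V →ₗ[F] W := LinearMap.pi fun z => (lcoeff F (z.2 : ℕ)) ∘ₗ R z.1
  have hfr : Module.finrank F W < Module.finrank F V := by
    have e1 : Module.finrank F W = M * (d + L + M) - M := by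
      have hs : ∑ r : Fin M, (d + L + 2 * (r : ℕ)) + M = M * (d + L + M) := by
        rw [Fin.sum_univ_eq_sum_range (fun r => d + L + 2 * r)]
        clear * -
        induction M with
        | zero => simp
        | succ n ih => rw [Finset.sum_range_succ]; nlinarith
      simp only [W, Module.finrank_fintype_fun_eq_card, Fintype.card_sigma, Fintype.card_fin]
      omega
    have e2 : Module.finrank F V = N ^ 3 * L * (d + 1) := by
      simp only [V]
      rw [Module.finrank_pi_fintype]
      have : Module.finrank F (degreeLT F (d + 1)) = d + 1 := by
        rw [(degreeLTEquiv F (d + 1)).finrank_eq]; simp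
      simp only [this, Finset.sum_const, Finset.card_univ, Fintype.card_prod, Fintype.card_fin,
        smul_eq_mul]
      ring
    rw [e1, e2]; omega
  have hfin : FiniteDimensional F (degreeLT F (d + 1)) :=
    (degreeLTEquiv F (d + 1)).symm.finiteDimensional
  obtain ⟨P, hPk, hP0⟩ := (Submodule.ne_bot_iff _).1
    (LinearMap.ker_ne_bot_of_finrank_lt (f := T) hfr)
  have hPdeg : ∀ y, (P y : F[X]).natDegree ≤ d := by
    intro y
    have := mem_degreeLT.1 (P y).2
    rw [← Nat.lt_succ_iff]
    by_cases hz : (P y : F[X]) = 0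
    · rw [hz]; simp
    · exact (natDegree_lt_iff_degree_lt hz).2 this
  have hR0 : ∀ r < M, R r P = 0 := by
    intro r hr
    ext m
    rw [coeff_zero]
    by_cases hm : m < d + L + 2 * r
    · have h3 := congrFun (LinearMap.mem_ker.1 hPk) ⟨⟨r, hr⟩, ⟨m, hm⟩⟩
      simpa [T] using h3
    · apply coeff_eq_zero_of_natDegree_lt
      refine lt_of_le_of_lt (b := d + L - 1 + 2 * r) ?_ ?_
      · rw [hRapp]
        refine natDegree_sum_le_of_forall_le _ _ fun y _ => ?_
        have h3 := hQdeg r y.1 _ (hPdeg y)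
        have h4 := natDegree_C_mul_X_pow_le (κ y.1) (y.2 : ℕ)
        refine natDegree_mul_le.trans ?_
        have := y.2.2
        omega
      · have : 0 < L := by
          rcases Nat.eq_zero_or_pos L with h | h
          · rw [h] at hcount; simp at hcount
          · exact h
        omega
  set Φ : F[X] := ∑ l : Fin L, (∑ x, (P (x, l) : F[X]) * fxg N e b1 b2 x) * X ^ (q * (l : ℕ)) with hΦ
  have hΦ0 : Φ ≠ 0 := by
    intro hz
    apply hP0
    have := fx_nonzero N hN b1 b2 h1 h2 h12 e d q L hd hq hfrob (fun x l => (P (x, l) : F[X]))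
      (fun x l => hPdeg _) hz
    funext y
    exact Subtype.ext (congrFun (congrFun this y.1) y.2)
  have hΦdeg : Φ.natDegree ≤ q * (L + 2) := by
    refine natDegree_sum_le_of_forall_le _ _ fun l _ => ?_
    refine natDegree_mul_le.trans ?_
    rw [natDegree_X_pow]
    have h3 : (∑ x, (P (x, l) : F[X]) * fxg N e b1 b2 x).natDegree ≤ d + 3 * ((N - 1) * e) := by
      refine natDegree_sum_le_of_forall_le _ _ fun x _ => ?_
      exact natDegree_mul_le.trans (Nat.add_le_add (hPdeg _) (fx_g_deg N e b1 b2 x))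
    have h4 : d ≤ e := by nlinarith [Nat.one_le_pow 2 N hNpos]
    have h5 : (N - 1) * e + e = N * e := by
      rw [← Nat.succ_mul, Nat.succ_eq_add_one, Nat.sub_add_cancel hNpos]
    have h6 : q * (l : ℕ) + q ≤ q * L := by
      rw [← Nat.mul_succ]; exact Nat.mul_le_mul_left _ l.2
    rw [mul_add]
    omega
  refine (fx_card_le Φ hΦ0 A M fun x hx => fx_dvd_of_hasse Φ x M fun r hr => ?_).trans hΦdeg
  obtain ⟨a1, a2, a3⟩ := hA x hx
  have hx1 : x ≠ 0 := by rintro rfl; rw [zero_pow he.ne'] at a1; exact hc1 a1.symm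
  have hx2 : x + b1 ≠ 0 := by intro h0; rw [h0, zero_pow he.ne'] at a2; exact hc2 a2.symm
  have hx3 : x + b2 ≠ 0 := by intro h0; rw [h0, zero_pow he.ne'] at a3; exact hc3 a3.symm
  have hhx : h.eval x ≠ 0 := by
    rw [hh]; simp [hx1, hx2, hx3]
  have hgx : ∀ y, (fxg N e b1 b2 y).eval x = κ y := by
    intro y
    simp only [fxg, κ, eval_mul, eval_pow, eval_add, eval_X, eval_C, add_zero]
    rw [mul_comm _ e, mul_comm _ e, mul_comm _ e, pow_mul, pow_mul, pow_mul, a1, a2, a3]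
  have hmul : (h.eval x) ^ r * (hasseDeriv r Φ).eval x = (R r P).eval x := by
    rw [hRapp, hΦ, map_sum, eval_finsetSum, eval_finsetSum, Finset.mul_sum,
      Fintype.sum_prod_type_right]
    refine Finset.sum_congr rfl fun l _ => ?_
    rw [fx_hasse_mul_X_pow q hch l r (hr.trans_le hMq), map_sum, eval_mul, eval_finsetSum,
      Finset.sum_mul, Finset.mul_sum]
    refine Finset.sum_congr rfl fun y _ => ?_
    have h9 := congrArg (eval x) (hQ r y (P (y, l)))
    rw [eval_mul, eval_mul, eval_pow, hgx] at h9
    rw [← mul_assoc, h9]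
    simp only [eval_mul, eval_C, eval_pow, eval_X]
    rw [pow_mul, hFq]
    ring
  rw [hR0 r hr, eval_zero] at hmul
  exact (mul_eq_zero.1 hmul).resolve_left (pow_ne_zero _ hhx)

lemma fx_arith1 (n σ q d t M : ℤ) (hn : 2744 ≤ n) (hσn : 4 * n ≤ σ) (hs : σ * σ ≤ q)
    (hD : q ≤ n * (d + 1) + 3 * n) (ht1 : n * t ≤ 2 * σ) (ht2 : 2 * σ < n * t + n)
    (hM : 2 * σ = M + 3) (hd : 0 ≤ d) :
    M * (d + (t + 5) + M) < n * (t + 5) * (d + 1) := by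
  obtain rfl : M = 2 * σ - 3 := by linarith
  have k1 : n * ((2 * σ - 3) * (t + 2 * σ + 1)) < n * ((4 * n + 4) * (d + 1)) := by
    have k2 : n * ((2 * σ - 3) * (t + 2 * σ + 1)) ≤ (2 * σ - 3) * (2 * σ + 2 * n * σ + n) := by
      have h1 : n * (t + 2 * σ + 1) ≤ 2 * σ + 2 * n * σ + n := by linarith
      have h0 : 0 ≤ 2 * σ - 3 := by linarith
      have := mul_le_mul_of_nonneg_left h1 h0
      linarith
    have k3 : (4 * n + 4) * (σ * σ - 3 * n) ≤ (4 * n + 4) * (n * (d + 1)) :=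
      mul_le_mul_of_nonneg_left (by linarith) (by linarith)
    have k4 : n * (4 * n) ≤ n * σ := mul_le_mul_of_nonneg_left hσn (by linarith)
    have k5 : 0 ≤ n * n := by positivity
    linarith
  have k4 := lt_of_mul_lt_mul_left k1 (by linarith)
  have k5 : (2 * σ + 4 * n + 1) * (d + 1) ≤ n * (t + 5) * (d + 1) :=
    mul_le_mul_of_nonneg_right (by linarith) (by linarith)
  have k6 : (2 * σ - 3) * (d + (t + 5) + (2 * σ - 3)) =
    (2 * σ - 3) * (d + 1) + (2 * σ - 3) * (t + 2 * σ + 1) := by ring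
  rw [k6]
  linarith

lemma fx_arith2 (n σ q t Q : ℝ) (hQ2 : Q * Q = q) (hQ0 : 0 ≤ Q) (hQσ : Q < σ + 1)
    (hσQ : σ ≤ Q) (hn : 2744 ≤ n) (hσn : 4 * n ≤ σ) (ht : n * t ≤ 2 * σ) :
    q * (t + 5 + 2) ≤ (2 * σ - 3) * (q / n + 18 / 5 * Q) := by
  have hnpos : 0 < n := by linarith
  have hq0 : 0 ≤ q := by rw [← hQ2]; positivity
  obtain ⟨z, hz⟩ : ∃ z, z = q / n := ⟨_, rfl⟩
  have hzq : q = n * z := by rw [hz]; field_simp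
  have hz0 : 0 ≤ z := by rw [hz]; positivity
  rw [← hz]
  have hz1 : 2744 * z ≤ Q * Q := by rw [hQ2, hzq]; exact mul_le_mul_of_nonneg_right hn hz0
  have a1 : q * t ≤ 2 * σ * z := by
    have := mul_le_mul_of_nonneg_right ht hz0
    rw [hzq]; linarith
  have a2 : 7 * (Q * Q) + 3 * z ≤ 18 / 5 * Q * (2 * σ - 3) := by
    have h1 : 18 / 5 * Q * (2 * Q - 5) ≤ 18 / 5 * Q * (2 * σ - 3) :=
      mul_le_mul_of_nonneg_left (by linarith) (by positivity)
    have hQbig : (10976 : ℝ) ≤ Q := by linarith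
    have := mul_le_mul_of_nonneg_right hQbig hQ0
    linarith
  rw [← hQ2] at a1 ⊢
  linarith


lemma fx_cell {F : Type*} [Field F] [Fintype F] (N e q p k : ℕ) (hp : p.Prime) [CharP F p]
    (hqp : q = p ^ k) (hF : Fintype.card F = q) (hq : q = N * e + 1) (hN14 : 14 ≤ N)
    (hbig : 16 * N ^ 6 < q) (b1 b2 : F) (h1 : b1 ≠ 0) (h2 : b2 ≠ 0) (h12 : b1 ≠ b2)
    (c1 c2 c3 : F) (hc1 : c1 ≠ 0) (hc2 : c2 ≠ 0) (hc3 : c3 ≠ 0)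
    (A : Finset F) (hA : ∀ x ∈ A, x ^ e = c1 ∧ (x + b1) ^ e = c2 ∧ (x + b2) ^ e = c3) :
    (A.card : ℝ) ≤ q / (N : ℝ) ^ 3 + 18 / 5 * Real.sqrt q := by
  have : NeZero N := ⟨by omega⟩
  have : Fact p.Prime := ⟨hp⟩
  have hFq : ∀ x : F, x ^ q = x := fun x => by rw [← hF]; exact FiniteField.pow_card x
  have hq0 : (q : F) = 0 := by rw [← hF]; exact FiniteField.cast_card_eq_zero F
  have hN : (N : F) ≠ 0 := by
    intro h
    rw [hq] at hq0
    push_cast at hq0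
    rw [h] at hq0
    simp at hq0
  have hfrob : ∀ b : F, (X + C b : F[X]) ^ q = X ^ q + C b := by
    intro b
    rw [hqp, add_pow_char_pow, ← C_pow, ← hqp, hFq]
  have hch : ∀ s, 0 < s → s < q → (q.choose s : F) = 0 := by
    intro s hs hsq
    rw [CharP.cast_eq_zero_iff F p, hqp]
    exact hp.dvd_choose_pow hs.ne' (by rw [← hqp]; omega)
  set n := N ^ 3 with hn
  set σ := Nat.sqrt q with hσ
  have hs1 : σ * σ ≤ q := Nat.sqrt_le q
  have hs2 : q < (σ + 1) * (σ + 1) := Nat.lt_succ_sqrt q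
  have hn14 : 2744 ≤ n := by
    rw [hn]; calc 2744 = 14 ^ 3 := by norm_num
      _ ≤ N ^ 3 := Nat.pow_le_pow_left hN14 3
  have hbig' : 16 * (n * n) < q := by rw [hn]; calc _ = 16 * N ^ 6 := by ring
                                        _ < q := hbig
  have hσn : 4 * n ≤ σ := by
    rw [hσ, Nat.le_sqrt]; nlinarith
  have hN2 : 0 < N ^ 2 := by positivity
  have hnN : n = N * N ^ 2 := by rw [hn]; ring
  obtain ⟨d, hd⟩ : ∃ d, (e - 1) / N ^ 2 = d + 2 := by
    have : 2 ≤ (e - 1) / N ^ 2 := by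
      rw [Nat.le_div_iff_mul_le hN2]
      have h3 : N * (16 * (N ^ 2 * n)) < N * e + 1 := by
        rw [← hq]; calc _ = 16 * (n * n) := by rw [hnN]; ring
          _ < q := hbig'
      have h4 : 16 * (N ^ 2 * n) ≤ e := by
        by_contra hcon
        push Not at hcon
        nlinarith
      have : N ^ 2 * 1 ≤ N ^ 2 * n := Nat.mul_le_mul_left _ (by omega)
      omega
    exact ⟨_, (Nat.sub_add_cancel this).symm⟩
  have hd1 : N ^ 2 * (d + 2) ≤ e - 1 := by rw [← hd]; exact Nat.mul_div_le _ _
  have hd2 : e - 1 < N ^ 2 * (d + 2) + N ^ 2 := by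
    have := Nat.lt_mul_div_succ (e - 1) hN2
    rw [hd] at this
    nlinarith
  have he : 0 < e := by
    rcases Nat.eq_zero_or_pos e with h | h
    · rw [h] at hq; nlinarith
    · exact h
  have hdlt : N ^ 2 * (d + 2) < e := by omega
  have hDn : q ≤ n * (d + 1) + 3 * n := by
    have h3 : e ≤ N ^ 2 * (d + 3) := by
      have : N ^ 2 * (d + 3) = N ^ 2 * (d + 2) + N ^ 2 := by ring
      omega
    have h4 : N * e ≤ n * (d + 3) := by
      rw [hnN, mul_assoc]; exact Nat.mul_le_mul_left _ h3
    rw [hq]; nlinarith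
  set t := 2 * σ / n with ht
  have ht1 : n * t ≤ 2 * σ := Nat.mul_div_le _ _
  have ht2 : 2 * σ < n * t + n := by
    have := Nat.lt_mul_div_succ (2 * σ) (show 0 < n by omega)
    rw [← ht] at this
    nlinarith
  obtain ⟨M, hM⟩ : ∃ M, 2 * σ = M + 3 := ⟨2 * σ - 3, by omega⟩
  have hcount : M * (d + (t + 5) + M) < N ^ 3 * (t + 5) * (d + 1) := by
    rw [← hn]
    exact_mod_cast fx_arith1 n σ q d t M (by exact_mod_cast hn14) (by exact_mod_cast hσn)
      (by exact_mod_cast hs1) (by exact_mod_cast hDn) (by exact_mod_cast ht1)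
      (by exact_mod_cast ht2) (by exact_mod_cast hM) (by positivity)
  have hMq : M ≤ q := by nlinarith
  have hmain := fx_stepanov N hN b1 b2 h1 h2 h12 e d q (t + 5) M hdlt hq hfrob hch hFq hMq hcount
    c1 c2 c3 hc1 hc2 hc3 A hA
  set Q := Real.sqrt q with hQ
  have hQ2 : Q * Q = q := Real.mul_self_sqrt (Nat.cast_nonneg q)
  have hQ0 : 0 ≤ Q := Real.sqrt_nonneg _
  have hQσ : Q < σ + 1 := by
    rw [hQ, Real.sqrt_lt' (by positivity), sq]
    exact_mod_cast hs2
  have hσQ : (σ : ℝ) ≤ Q := by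
    rw [hQ]; apply Real.le_sqrt_of_sq_le; rw [sq]; exact_mod_cast hs1
  have hnR : (2744 : ℝ) ≤ n := by exact_mod_cast hn14
  have hnR' : (n : ℝ) = (N : ℝ) ^ 3 := by rw [hn]; push_cast; rfl
  have hσnR : 4 * (n : ℝ) ≤ σ := by exact_mod_cast hσn
  have hMR : (M : ℝ) = 2 * σ - 3 := by
    have : (2 * σ : ℝ) = M + 3 := by exact_mod_cast hM
    linarith
  have hmR : (M : ℝ) * A.card ≤ q * (t + 5 + 2) := by exact_mod_cast hmain
  have htR : (n : ℝ) * t ≤ 2 * σ := by exact_mod_cast ht1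
  rw [← hnR']
  have hMpos : (0 : ℝ) < M := by rw [hMR]; linarith
  refine le_of_mul_le_mul_left (hmR.trans ?_) hMpos
  rw [hMR]
  exact fx_arith2 n σ q t Q hQ2 hQ0 hQσ hσQ hnR hσnR htR

lemma fx_count {F : Type*} [Field F] [Fintype F] [DecidableEq F] (N e q p k : ℕ) (hp : p.Prime) [CharP F p]
    (hqp : q = p ^ k) (hF : Fintype.card F = q) (hq : q = N * e + 1) (hN14 : 14 ≤ N)
    (hbig : 16 * N ^ 6 < q) (b1 b2 : F) (h1 : b1 ≠ 0) (h2 : b2 ≠ 0) (h12 : b1 ≠ b2)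
    (Y : Finset (F × F × F)) (hY : ∀ c ∈ Y, c.1 ≠ 0 ∧ c.2.1 ≠ 0 ∧ c.2.2 ≠ 0) :
    (((Finset.univ.filter fun x : F => (x ^ e, (x + b1) ^ e, (x + b2) ^ e) ∈ Y).card : ℕ) : ℝ) ≤
      Y.card * (q / (N : ℝ) ^ 3 + 18 / 5 * Real.sqrt q) := by
  rw [Finset.card_eq_sum_card_fiberwise (f := fun x : F => (x ^ e, (x + b1) ^ e, (x + b2) ^ e))
    (t := Y) (fun x hx => by simpa using hx)]
  push_cast
  rw [← nsmul_eq_mul]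
  refine Finset.sum_le_card_nsmul _ _ _ fun c hc => ?_
  obtain ⟨a1, a2, a3⟩ := hY c hc
  refine fx_cell N e q p k hp hqp hF hq hN14 hbig b1 b2 h1 h2 h12 c.1 c.2.1 c.2.2 a1 a2 a3 _ ?_
  intro x hx
  have := (Finset.mem_filter.1 hx).2
  rw [← this]
  exact ⟨rfl, rfl, rfl⟩

lemma fx_two_sided {F : Type*} [Field F] [Fintype F] [DecidableEq F] (N e q p k : ℕ) (hp : p.Prime)
    [CharP F p]
    (hqp : q = p ^ k) (hF : Fintype.card F = q) (hq : q = N * e + 1) (hN14 : 14 ≤ N)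
    (hbig : 16 * N ^ 6 < q) (b1 b2 : F) (h1 : b1 ≠ 0) (h2 : b2 ≠ 0) (h12 : b1 ≠ b2)
    (S : Finset F) (hS : ∀ c ∈ S, c ^ N = 1) :
    (((Finset.univ.filter fun x : F => x ^ e ∈ S ∧ (x + b1) ^ e ∈ S ∧ (x + b2) ^ e ∈ S).card : ℕ) : ℝ) ≤
      (S.card : ℝ) ^ 3 * (q / (N : ℝ) ^ 3 + 18 / 5 * Real.sqrt q) ∧
    (q : ℝ) - 3 - ((N : ℝ) ^ 3 - (S.card : ℝ) ^ 3) * (q / (N : ℝ) ^ 3 + 18 / 5 * Real.sqrt q) ≤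
    (((Finset.univ.filter fun x : F => x ^ e ∈ S ∧ (x + b1) ^ e ∈ S ∧ (x + b2) ^ e ∈ S).card : ℕ) : ℝ) := by
  have hN0 : N ≠ 0 := by omega
  set B : ℝ := q / (N : ℝ) ^ 3 + 18 / 5 * Real.sqrt q with hB
  have hB0 : 0 ≤ B := by positivity
  have hne : ∀ c : F, c ^ N = 1 → c ≠ 0 := by
    rintro c hc rfl
    rw [zero_pow hN0] at hc
    exact zero_ne_one hc
  set m : Finset F := Finset.univ.filter fun c : F => c ^ N = 1 with hm
  have hmN : m.card ≤ N := by
    have : m ⊆ (nthRoots N (1 : F)).toFinset := by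
      intro c hc
      rw [Multiset.mem_toFinset, mem_nthRoots (by omega)]
      exact (Finset.mem_filter.1 hc).2
    exact (Finset.card_le_card this).trans ((Multiset.toFinset_card_le _).trans (card_nthRoots N 1))
  have hSm : S ⊆ m := fun c hc => Finset.mem_filter.2 ⟨Finset.mem_univ _, hS c hc⟩
  have hcnt := fx_count N e q p k hp hqp hF hq hN14 hbig b1 b2 h1 h2 h12
  set S3 := S ×ˢ S ×ˢ S with hS3
  set m3 := m ×ˢ m ×ˢ m with hm3
  have hS3m : S3 ⊆ m3 := Finset.product_subset_product hSm (Finset.product_subset_product hSm hSm)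
  have hm3ne : ∀ c ∈ m3, c.1 ≠ 0 ∧ c.2.1 ≠ 0 ∧ c.2.2 ≠ 0 := by
    intro c hc
    simp only [hm3, hm, Finset.mem_product, Finset.mem_filter, Finset.mem_univ, true_and] at hc
    exact ⟨hne _ hc.1, hne _ hc.2.1, hne _ hc.2.2⟩
  have hS3c : (S3.card : ℝ) = (S.card : ℝ) ^ 3 := by
    rw [hS3, Finset.card_product, Finset.card_product]; push_cast; ring
  have hm3c : (m3.card : ℝ) ≤ (N : ℝ) ^ 3 := by
    rw [hm3, Finset.card_product, Finset.card_product]; push_cast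
    have : (m.card : ℝ) ≤ N := by exact_mod_cast hmN
    calc (m.card : ℝ) * (m.card * m.card) = (m.card : ℝ) ^ 3 := by ring
      _ ≤ _ := by gcongr
  have hTeq : (Finset.univ.filter fun x : F => x ^ e ∈ S ∧ (x + b1) ^ e ∈ S ∧ (x + b2) ^ e ∈ S) =
      Finset.univ.filter fun x : F => (x ^ e, (x + b1) ^ e, (x + b2) ^ e) ∈ S3 := by
    ext x; simp [hS3]
  rw [hTeq]
  refine ⟨?_, ?_⟩
  · rw [← hS3c]
    exact hcnt S3 (fun c hc => hm3ne c (hS3m hc))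
  · have hc := hcnt (m3 \ S3) (fun c hc => hm3ne c (Finset.mem_sdiff.1 hc).1)
    rw [Finset.card_sdiff_of_subset hS3m, Nat.cast_sub (Finset.card_le_card hS3m), hS3c] at hc
    have hcov : (Finset.univ : Finset F) ⊆
        ((Finset.univ.filter fun x : F => (x ^ e, (x + b1) ^ e, (x + b2) ^ e) ∈ S3) ∪
        (Finset.univ.filter fun x : F => (x ^ e, (x + b1) ^ e, (x + b2) ^ e) ∈ m3 \ S3)) ∪
        {0, -b1, -b2} := by
      intro x _
      have hpow : ∀ y : F, y ≠ 0 → y ^ e ∈ m := by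
        intro y hy
        refine Finset.mem_filter.2 ⟨Finset.mem_univ _, ?_⟩
        rw [← pow_mul, mul_comm, show N * e = Fintype.card F - 1 by omega]
        exact FiniteField.pow_card_sub_one_eq_one y hy
      by_cases hx0 : x = 0
      · simp [hx0]
      by_cases hx1 : x + b1 = 0
      · simp [eq_neg_of_add_eq_zero_left hx1]
      by_cases hx2 : x + b2 = 0
      · simp [eq_neg_of_add_eq_zero_left hx2]
      have hxm : (x ^ e, (x + b1) ^ e, (x + b2) ^ e) ∈ m3 := by
        simp only [hm3, Finset.mem_product]
        exact ⟨hpow _ hx0, hpow _ hx1, hpow _ hx2⟩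
      refine Finset.mem_union_left _ ?_
      rw [Finset.mem_union, Finset.mem_filter, Finset.mem_filter, Finset.mem_sdiff]
      by_cases hxS : (x ^ e, (x + b1) ^ e, (x + b2) ^ e) ∈ S3
      · exact Or.inl ⟨Finset.mem_univ _, hxS⟩
      · exact Or.inr ⟨Finset.mem_univ _, hxm, hxS⟩
    have h5 := (Finset.card_le_card hcov).trans ((Finset.card_union_le _ _).trans
      (Nat.add_le_add (Finset.card_union_le _ _) (Finset.card_le_three)))
    rw [Finset.card_univ, hF] at h5
    have h6 := (Nat.cast_le (α := ℝ)).2 h5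
    push_cast at h6
    have h7 : ((m3.card : ℝ) - (S.card : ℝ) ^ 3) * B ≤ ((N : ℝ) ^ 3 - (S.card : ℝ) ^ 3) * B :=
      mul_le_mul_of_nonneg_right (by linarith) hB0
    rw [← hB] at hc
    linarith


end FXaux

/-- Feng–Xiang setting: for the Feng–Xiang skew Hadamard difference set
`D = ⋃_{i∈I} ω^i⟨ω^N⟩` in `𝔽_q` and any `a ∈ 𝔽_p^* \ {1}`, any two triple intersection
numbers differ by at most `4N³√q`. -/
theorem tripleInt_spread_bound
    (p1 m N p f s q : ℕ)
    (hp1 : p1.Prime) (hp1mod : p1 % 8 = 7) (hm : 1 ≤ m) (hN : N = 2 * p1 ^ m)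
    (hp : p.Prime) (hpmod : p % 4 = 3)
    (hf : f = N.totient / 2) (hord : orderOf (p : ZMod N) = f)
    (hs : Odd s) (hq : q = p ^ (f * s))
    (I : Finset ℕ) (hIN : ∀ i ∈ I, i < N)
    (hIcov : ∀ r : ZMod (p1 ^ m), ∃ i ∈ I, (i : ZMod (p1 ^ m)) = r)
    (F : Type*) [Field F] [Fintype F] (hF : Fintype.card F = q)
    (ω : F) (hω : orderOf ω = q - 1)
    (D : Set F) (hD : D = {x : F | ∃ i ∈ I, ∃ j : ℕ, x = ω ^ (i + N * j)})
    (a : F) (ha0 : a ≠ 0) (ha1 : a ≠ 1) (hap : a ^ p = a)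
    (β β' : F) (hβ : β ≠ 0) (hβ' : β' ≠ 0) :
    |(tripleInt β a D : ℝ) - (tripleInt β' a D : ℝ)| ≤ 4 * N ^ 3 * Real.sqrt q := by
  classical
  have : Fact p.Prime := ⟨hp⟩
  have hN14 : 14 ≤ N := by
    have h1 : 7 ≤ p1 := by omega
    have h2 : p1 ≤ p1 ^ m := Nat.le_self_pow (by omega) p1
    omega
  have hq2 : 2 ≤ q := by rw [← hF]; exact Fintype.one_lt_card
  have hqN : ((q : ℕ) : ZMod N) = 1 := by
    rw [hq]; push_cast
    rw [pow_mul, ← hord, pow_orderOf_eq_one, one_pow]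
  obtain ⟨e, he⟩ : N ∣ q - 1 := by
    rw [← Nat.modEq_iff_dvd' (by omega)]
    apply Nat.ModEq.symm
    rw [← ZMod.natCast_eq_natCast_iff]
    simpa using hqN
  have hqe : q = N * e + 1 := by omega
  have he0 : 0 < e := by
    rcases Nat.eq_zero_or_pos e with h | h
    · rw [h] at hqe; omega
    · exact h
  have hchar : CharP F p := charP_of_card_eq_prime_pow (hF.trans hq)
  have hω1 : ω ^ (N * e) = 1 := by rw [← he, ← hω]; exact pow_orderOf_eq_one ω
  have hω0 : ω ≠ 0 := by
    rintro rfl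
    rw [zero_pow (by positivity)] at hω1
    exact zero_ne_one hω1
  have hprim : IsPrimitiveRoot ω (N * e) := by rw [← he, ← hω]; exact IsPrimitiveRoot.orderOf ω
  set S : Finset F := I.image (fun i => (ω ^ i) ^ e) with hSdef
  have hS : ∀ c ∈ S, c ^ N = 1 := by
    intro c hc
    obtain ⟨i, _, rfl⟩ := Finset.mem_image.1 hc
    calc ((ω ^ i) ^ e) ^ N = (ω ^ (N * e)) ^ i := by ring
      _ = 1 := by rw [hω1, one_pow]
  have hDS : ∀ x : F, x ∈ D ↔ x ^ e ∈ S := by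
    intro x
    rw [hD, Set.mem_ofPred_eq, hSdef, Finset.mem_image]
    constructor
    · rintro ⟨i, hi, j, rfl⟩
      refine ⟨i, hi, ?_⟩
      calc (ω ^ i) ^ e = (ω ^ i) ^ e * (ω ^ (N * e)) ^ j := by rw [hω1, one_pow, mul_one]
        _ = (ω ^ (i + N * j)) ^ e := by ring
    · rintro ⟨i, hi, hx⟩
      have hx0 : x ≠ 0 := by
        rintro rfl
        rw [zero_pow he0.ne'] at hx
        exact pow_ne_zero _ (pow_ne_zero _ hω0) hx
      have hx1 : x ^ (N * e) = 1 := by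
        rw [← he, ← hF]; exact FiniteField.pow_card_sub_one_eq_one x hx0
      have : NeZero (N * e) := ⟨by positivity⟩
      obtain ⟨k, _, rfl⟩ := hprim.eq_pow_of_pow_eq_one hx1
      rw [← pow_mul, ← pow_mul, (hprim.isOfFinOrder (by positivity)).pow_eq_pow_iff_modEq,
        ← hprim.eq_orderOf] at hx
      have hik : i ≡ k [MOD N] := Nat.ModEq.mul_right_cancel' he0.ne' hx
      have hle : i ≤ k + N * (e * i) := by
        have : 1 * i ≤ (N * e) * i := Nat.mul_le_mul_right _ (Nat.succ_le_of_lt (by positivity))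
        nlinarith
      have hik' : i ≡ k + N * (e * i) [MOD N] := by
        have : k + N * (e * i) ≡ k [MOD N] := by simp [Nat.ModEq]
        exact hik.trans this.symm
      obtain ⟨j, hj⟩ := (Nat.modEq_iff_dvd' hle).1 hik'
      refine ⟨i, hi, j, ?_⟩
      rw [show i + N * j = k + N * (e * i) by omega]
      calc ω ^ k = ω ^ k * (ω ^ (N * e)) ^ i := by rw [hω1, one_pow, mul_one]
        _ = _ := by ring
  have hT : ∀ b : F, tripleInt b a D =
      (Finset.univ.filter fun x : F => x ^ e ∈ S ∧ (x + b) ^ e ∈ S ∧ (x + a * b) ^ e ∈ S).card := by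
    intro b
    rw [tripleInt, ← Set.ncard_coe_finset]
    congr 1
    ext x
    simp [hDS]
  have hTq : ∀ b : F, (tripleInt b a D : ℝ) ≤ q := by
    intro b
    rw [hT, ← hF]
    exact_mod_cast Finset.card_le_univ _
  have hQ2 : Real.sqrt q * Real.sqrt q = q := Real.mul_self_sqrt (Nat.cast_nonneg q)
  have hN3 : (14 : ℝ) ^ 3 ≤ (N : ℝ) ^ 3 := by
    have : (14 : ℝ) ≤ N := by exact_mod_cast hN14
    gcongr
  rcases Nat.lt_or_ge (16 * N ^ 6) q with hbig | hsmall
  · have hgen := fun (b : F) (hb : b ≠ 0) =>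
      fx_two_sided N e q p (f * s) hp hq hF hqe hN14 hbig b (a * b) hb (mul_ne_zero ha0 hb)
        (fun h => ha1 (mul_right_cancel₀ hb (by rw [one_mul]; exact h.symm))) S hS
    simp only [← hT] at hgen
    obtain ⟨u1, l1⟩ := hgen β hβ
    obtain ⟨u2, l2⟩ := hgen β' hβ'
    have hQ1 : 1 ≤ Real.sqrt q := by
      rw [Real.one_le_sqrt]; exact_mod_cast (by omega : 1 ≤ q)
    have hdiv : (N : ℝ) ^ 3 * (q / (N : ℝ) ^ 3) = q := by
      have : (N : ℝ) ^ 3 ≠ 0 := by positivity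
      field_simp
    have hbd : (N : ℝ) ^ 3 * (q / (N : ℝ) ^ 3 + 18 / 5 * Real.sqrt q) - q + 3 ≤
        4 * N ^ 3 * Real.sqrt q := by
      rw [mul_add, hdiv]
      have := mul_le_mul hN3 hQ1 zero_le_one (by positivity)
      linarith
    rw [abs_le]
    constructor <;> linarith
  · have hQ4 : Real.sqrt q ≤ 4 * N ^ 3 := by
      rw [Real.sqrt_le_left (by positivity)]
      have : (q : ℝ) ≤ 16 * N ^ 6 := by exact_mod_cast hsmall
      nlinarith
    have hqb : (q : ℝ) ≤ 4 * N ^ 3 * Real.sqrt q := by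
      have := mul_le_mul_of_nonneg_right hQ4 (Real.sqrt_nonneg (q : ℝ))
      linarith
    have h1 := hTq β
    have h2 := hTq β'
    have h3 : (0 : ℝ) ≤ tripleInt β a D := Nat.cast_nonneg _
    have h4 : (0 : ℝ) ≤ tripleInt β' a D := Nat.cast_nonneg _
    rw [abs_le]
    constructor <;> linarith
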